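/- arXiv:math/0006221 — 3 statements merged into one kernel-verified Lean document; each statement's English description precedes it below -/
import Mathlib

section
/- Let N ≥ 3, k ≥ 1, 0 ≤ l ≤ k, 1 ≤ r ≤ k be integers. Then dim_ℂ D_N(k,l,r) ≤ dim_ℂ D_N(k,l,r−1) + dim_ℂ D_{N−1}(k,l,k−r). -/
/-!
STATEMENT 4: For N ≥ 3, k ≥ 1, 0 ≤ l ≤ k, 1 ≤ r ≤ k,
dim_ℂ D_N(k,l,r) ≤ dim_ℂ D_N(k,l,r-1) + dim_ℂ D_{N-1}(k,l,k-r)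
(all these spaces being finite dimensional).
-/

open MvPolynomial

noncomputable section

def genSet (N k l r : ℕ) : Set (MvPolynomial (Fin N) ℂ) :=
  {p | ∃ h : 0 < N, p = X (⟨0, h⟩ : Fin N) ^ (l + 1)} ∪
  {p | ∃ h : 0 < N, p = X (⟨N - 1, Nat.sub_lt h Nat.one_pos⟩ : Fin N) ^ (r + 1)} ∪
  {p | ∃ i : ℕ, k + 1 ≤ i ∧ i ≤ N * (k + 1) ∧
      p = ∑ α ∈ Finset.univ.filter
            (fun α : Fin (k + 1) → Fin N => (∑ j, ((α j).1 + 1)) = i),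
          ∏ j, X (α j)}

def IdealN (N k l r : ℕ) : Ideal (MvPolynomial (Fin N) ℂ) := Ideal.span (genSet N k l r)

abbrev Dspace (N k l r : ℕ) := MvPolynomial (Fin N) ℂ ⧸ IdealN N k l r

/-- The relation `∑ X_{α_1} ⋯ X_{α_{k+1}}` of total (one-based) index `i`. -/
def powerCoeff (N k i : ℕ) : MvPolynomial (Fin N) ℂ :=
  ∑ α ∈ Finset.univ.filter (fun α : Fin (k + 1) → Fin N => (∑ j, ((α j).1 + 1)) = i),
    ∏ j, X (α j)

lemma powerCoeff_mem {N k i : ℕ} (l r : ℕ) (h₁ : k + 1 ≤ i) (h₂ : i ≤ N * (k + 1)) :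
    powerCoeff N k i ∈ IdealN N k l r :=
  Ideal.subset_span (Or.inr ⟨i, h₁, h₂, rfl⟩)

lemma X_zero_pow_mem (n k l r : ℕ) :
    (X 0 : MvPolynomial (Fin (n + 1)) ℂ) ^ (l + 1) ∈ IdealN (n + 1) k l r :=
  Ideal.subset_span (Or.inl (Or.inl ⟨n.succ_pos, rfl⟩))

lemma X_last_pow_mem (n k l r : ℕ) :
    (X (Fin.last n) : MvPolynomial (Fin (n + 1)) ℂ) ^ (r + 1) ∈ IdealN (n + 1) k l r :=
  Ideal.subset_span (Or.inl (Or.inr ⟨n.succ_pos, rfl⟩))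

lemma X_mem_radical (N k l r : ℕ) (i : Fin N) :
    (X i : MvPolynomial (Fin N) ℂ) ∈ (IdealN N k l r).radical := by
  induction i using WellFoundedLT.induction with
  | ind i ih =>
    have hi := i.2
    have hc : powerCoeff N k ((i.1 + 1) * (k + 1)) ∈ (IdealN N k l r).radical :=
      Ideal.le_radical (powerCoeff_mem l r (Nat.le_mul_of_pos_left _ (by omega))
        (Nat.mul_le_mul_right _ (by omega)))
    have hconst : (fun _ : Fin (k + 1) => i) ∈ Finset.univ.filter
        (fun α : Fin (k + 1) → Fin N => (∑ j, ((α j).1 + 1)) = (i.1 + 1) * (k + 1)) := by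
      simp [mul_comm]
    rw [powerCoeff, ← Finset.add_sum_erase _ _ hconst] at hc
    have hrest := (Ideal.add_mem_iff_left _ (Ideal.sum_mem _ fun α hα => ?_)).1 hc
    · rw [Finset.prod_const] at hrest
      exact Ideal.mem_radical_of_pow_mem hrest
    · simp only [Finset.mem_erase, Finset.mem_filter, Finset.mem_univ, true_and] at hα
      obtain ⟨hne, hsum⟩ := hα
      obtain ⟨j, hj⟩ : ∃ j, α j < i := by
        by_contra! hge
        refine hne (funext fun j => Fin.ext ?_)
        have := (Finset.sum_eq_sum_iff_of_le (s := Finset.univ)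
          (f := fun _ : Fin (k + 1) => i.1 + 1) (g := fun j => (α j).1 + 1)
          (fun j _ => by have := Fin.le_def.1 (hge j); omega)).1
          (by rw [hsum]; simp [mul_comm]) j (Finset.mem_univ j)
        omega
      exact Ideal.mem_of_dvd _ (Finset.dvd_prod_of_mem _ (Finset.mem_univ j)) (ih _ hj)

lemma finiteDimensional_quotient_of_X_mem_radical {σ K : Type*} [Finite σ] [Field K]
    (I : Ideal (MvPolynomial σ K)) (h : ∀ i, X i ∈ I.radical) :
    FiniteDimensional K (MvPolynomial σ K ⧸ I) := by
  have : Algebra.IsIntegral K (MvPolynomial σ K ⧸ I) := by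
    refine ⟨fun x => ?_⟩
    obtain ⟨p, rfl⟩ := Ideal.Quotient.mk_surjective x
    induction p using MvPolynomial.induction_on with
    | C a => exact isIntegral_algebraMap (R := K) (A := MvPolynomial σ K ⧸ I) (x := a)
    | add p q hp hq => rw [map_add]; exact hp.add hq
    | mul_X p i hp =>
      rw [map_mul]
      refine hp.mul ?_
      obtain ⟨n, hn⟩ := h i
      refine IsIntegral.of_pow n.succ_pos ?_
      rw [← map_pow, pow_succ, Ideal.Quotient.eq_zero_iff_mem.2 (I.mul_mem_right _ hn)]
      exact isIntegral_zero
  exact Algebra.IsIntegral.finite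

instance (N k l r : ℕ) : FiniteDimensional ℂ (Dspace N k l r) :=
  finiteDimensional_quotient_of_X_mem_radical _ (X_mem_radical N k l r)

lemma IdealN_pred_le (n k l r : ℕ) (hr : 1 ≤ r) :
    IdealN (n + 1) k l (r - 1) ≤ IdealN (n + 1) k l r ⊔ Ideal.span {X (Fin.last n) ^ r} := by
  refine Ideal.span_le.2 ?_
  rintro p ((⟨h, rfl⟩ | ⟨h, rfl⟩) | ⟨i, h₁, h₂, rfl⟩)
  · exact Ideal.mem_sup_left (X_zero_pow_mem n k l r)
  · rw [Nat.sub_add_cancel hr]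
    exact Ideal.mem_sup_right (Ideal.mem_span_singleton_self _)
  · exact Ideal.mem_sup_left (powerCoeff_mem l r h₁ h₂)

lemma IdealN_le_pred (n k l r : ℕ) (hr : 1 ≤ r) :
    IdealN (n + 1) k l r ≤ IdealN (n + 1) k l (r - 1) := by
  refine Ideal.span_le.2 ?_
  rintro p ((⟨h, rfl⟩ | ⟨h, rfl⟩) | ⟨i, h₁, h₂, rfl⟩)
  · exact X_zero_pow_mem n k l _
  · exact Ideal.pow_mem_of_pow_mem _ (X_last_pow_mem n k l (r - 1)) (by omega)
  · exact powerCoeff_mem l _ h₁ h₂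

lemma exists_rename_castSucc_add {R : Type*} [CommRing R] {n : ℕ}
    (p : MvPolynomial (Fin (n + 1)) R) :
    ∃ (q : MvPolynomial (Fin n) R) (d : MvPolynomial (Fin (n + 1)) R),
      p = rename Fin.castSucc q + X (Fin.last n) * d := by
  induction p using MvPolynomial.induction_on with
  | C a => exact ⟨C a, 0, by simp⟩
  | add p p' hp hp' =>
    obtain ⟨q, d, rfl⟩ := hp
    obtain ⟨q', d', rfl⟩ := hp'
    exact ⟨q + q', d + d', by rw [map_add]; ring⟩
  | mul_X p i hp =>
    obtain ⟨q, d, rfl⟩ := hp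
    induction i using Fin.lastCases with
    | last => exact ⟨0, rename Fin.castSucc q + X (Fin.last n) * d, by rw [map_zero]; ring⟩
    | cast i => exact ⟨q * X i, d * X i.castSucc, by rw [map_mul, rename_X]; ring⟩

lemma X_last_pow_card_dvd_prod {n m : ℕ} (α : Fin m → Fin (n + 1)) :
    (X (Fin.last n) : MvPolynomial (Fin (n + 1)) ℂ) ^
      (Finset.univ.filter fun j => α j = Fin.last n).card ∣ ∏ j, X (α j) := by
  rw [← Finset.prod_filter_mul_prod_filter_not Finset.univ (fun j => α j = Fin.last n)]
  refine Dvd.intro _ (congrArg (· * _) ?_)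
  rw [← Finset.prod_const]
  exact Finset.prod_congr rfl fun j hj => by rw [(Finset.mem_filter.1 hj).2]

lemma X_last_pow_mul_mem {n k l r : ℕ} {p : MvPolynomial (Fin (n + 1)) ℂ}
    (h : X (Fin.last n) ∣ p) : X (Fin.last n) ^ r * p ∈ IdealN (n + 1) k l r := by
  obtain ⟨q, rfl⟩ := h
  rw [← mul_assoc, ← pow_succ]
  exact Ideal.mul_mem_right _ _ (X_last_pow_mem n k l r)

lemma X_last_pow_mul_powerCoeff_mem {n k l r i : ℕ} (h₁ : k + 1 ≤ i) (h₂ : i ≤ n * (k + 1)) :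
    X (Fin.last n) ^ r * rename Fin.castSucc (powerCoeff n k i) ∈ IdealN (n + 1) k l r := by
  have h := Ideal.mul_mem_left _ (X (Fin.last n) ^ r)
    (powerCoeff_mem (N := n + 1) l r h₁ (h₂.trans (Nat.mul_le_mul_right _ n.le_succ)))
  rw [powerCoeff, ← Finset.sum_filter_add_sum_filter_not _ (fun α => ∀ j, α j ≠ Fin.last n),
    mul_add] at h
  have h' := (Ideal.add_mem_iff_left _ ?_).1 h
  · convert h' using 2
    rw [powerCoeff, map_sum]
    refine Finset.sum_bij (fun α _ j => (α j).castSucc) ?_ ?_ ?_ ?_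
    · intro α hα
      simpa using hα
    · intro α _ β _ hαβ
      exact funext fun j => Fin.castSucc_injective _ (congrFun hαβ j)
    · intro β hβ
      simp only [Finset.mem_filter, Finset.mem_univ, true_and] at hβ
      exact ⟨fun j => (β j).castPred (hβ.2 j), by simpa using hβ.1, by simp⟩
    · intro α _
      simp [map_prod]
  · rw [Finset.mul_sum]
    refine Ideal.sum_mem _ fun α hα => X_last_pow_mul_mem ?_
    have hα := (Finset.mem_filter.1 hα).2
    push Not at hα
    obtain ⟨j, hj⟩ := hα
    rw [← hj]
    exact Finset.dvd_prod_of_mem _ (Finset.mem_univ j)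

lemma prod_X_eq_of_card_le {m k r : ℕ} (hr : r ≤ k) {α : Fin (k + 1) → Fin (m + 2)}
    (hα : ∑ j, ((α j).1 + 1) = (k + 1) * (m + 1) + r)
    (hs : (Finset.univ.filter fun j => α j = Fin.last (m + 1)).card ≤ r) :
    (∏ j, X (α j) : MvPolynomial (Fin (m + 2)) ℂ) =
      X (Fin.last (m + 1)) ^ r * X (Fin.last m).castSucc ^ (k - r + 1) := by
  have hcard := Finset.card_filter_add_card_filter_not (s := Finset.univ)
    (fun j => α j = Fin.last (m + 1))
  rw [Finset.card_univ, Fintype.card_fin] at hcard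
  have hdef : ∑ j, (m + 1 - (α j).1) = k + 1 - r := by
    have : ∑ j, (m + 1 - (α j).1) + ∑ j, ((α j).1 + 1) = (k + 1) * (m + 2) := by
      rw [← Finset.sum_add_distrib, Finset.sum_congr rfl (g := fun _ => m + 2)]
      · simp
      · intro j _
        have := (α j).2
        omega
    rw [hα] at this
    have e : (k + 1) * (m + 2) = (k + 1) * (m + 1) + (k + 1) := by ring
    omega
  have hle : ∀ j ∈ Finset.univ, (if ¬ α j = Fin.last (m + 1) then 1 else 0) ≤ m + 1 - (α j).1 := by
    intro j _
    have := (α j).2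
    split_ifs with h
    · omega
    · have : (α j).1 ≠ m + 1 := fun h' => h (Fin.ext h')
      omega
  have hsum := Finset.sum_le_sum hle
  rw [← Finset.card_filter, hdef] at hsum
  have heq := (Finset.sum_eq_sum_iff_of_le hle).1 (by rw [← Finset.card_filter, hdef]; omega)
  have hX : ∀ j ∈ Finset.univ, (X (α j) : MvPolynomial (Fin (m + 2)) ℂ) =
      if α j = Fin.last (m + 1) then X (Fin.last (m + 1)) else X (Fin.last m).castSucc := by
    intro j hj
    split_ifs with h
    · rw [h]
    · have := heq j hj
      rw [if_pos h] at this
      congr 1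
      apply Fin.ext
      simp only [Fin.val_castSucc, Fin.val_last]
      omega
  rw [Finset.prod_congr rfl hX, Finset.prod_ite, Finset.prod_const, Finset.prod_const]
  congr 2 <;> omega

lemma X_last_pow_mul_X_pow_mem (m k l r : ℕ) (hr : r ≤ k) :
    (X (Fin.last (m + 1)) ^ r * X (Fin.last m).castSucc ^ (k - r + 1) :
      MvPolynomial (Fin (m + 2)) ℂ) ∈ IdealN (m + 2) k l r := by
  have h := powerCoeff_mem (N := m + 2) (k := k) (i := (k + 1) * (m + 1) + r) l r
    (by nlinarith) (by nlinarith)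
  rw [powerCoeff, ← Finset.sum_filter_add_sum_filter_not _
    (fun α => (Finset.univ.filter fun j => α j = Fin.last (m + 1)).card ≤ r)] at h
  have h' := (Ideal.add_mem_iff_left _ (Ideal.sum_mem _ fun α hα => ?_)).1 h
  · rw [Finset.sum_congr rfl (g := fun _ =>
      X (Fin.last (m + 1)) ^ r * X (Fin.last m).castSucc ^ (k - r + 1)) ?_,
      Finset.sum_const] at h'
    · set c := Finset.card _ with hc
      have hc0 : (c : ℂ) ≠ 0 := by
        rw [Nat.cast_ne_zero, hc]
        refine Finset.card_ne_zero.2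
          ⟨fun j => if j.1 < r then Fin.last (m + 1) else (Fin.last m).castSucc, ?_⟩
        have hlt : (Finset.univ.filter fun j : Fin (k + 1) => j.1 < r).card = r := by
          rw [Fin.card_filter_val_lt]
          omega
        have hne : (Fin.last m).castSucc ≠ Fin.last (m + 1) := (Fin.castSucc_lt_last _).ne
        have hval : ∀ j : Fin (k + 1),
            (if j.1 < r then Fin.last (m + 1) else (Fin.last m).castSucc).1 + 1 =
              (m + 1) + if j.1 < r then 1 else 0 := by
          intro j
          split_ifs <;> simp
        simp only [Finset.mem_filter, Finset.mem_univ, true_and, hval]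
        refine ⟨?_, ?_⟩
        · rw [Finset.sum_add_distrib, ← Finset.card_filter, hlt]
          simp
        · refine (Finset.card_le_card fun j => ?_).trans hlt.le
          simp only [Finset.mem_filter, Finset.mem_univ, true_and]
          intro hj
          by_contra hjr
          rw [if_neg hjr] at hj
          exact hne hj
      have := Ideal.mul_mem_left _ (C (c : ℂ)⁻¹) h'
      rwa [nsmul_eq_mul, ← mul_assoc, ← map_natCast (C (σ := Fin (m + 2)) (R := ℂ)), ← C_mul,
        inv_mul_cancel₀ hc0, C_1, one_mul] at this
    · intro α hα
      simp only [Finset.mem_filter, Finset.mem_univ, true_and] at hα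
      exact prod_X_eq_of_card_le hr hα.1 hα.2
  · have hα := (Finset.mem_filter.1 hα).2
    exact Ideal.mem_of_dvd _ ((pow_dvd_pow _ (by omega)).trans (X_last_pow_card_dvd_prod α))
      (X_last_pow_mem (m + 1) k l r)

lemma X_last_pow_mul_rename_mem {m k l r : ℕ} (hr : r ≤ k) {p : MvPolynomial (Fin (m + 1)) ℂ}
    (hp : p ∈ IdealN (m + 1) k l (k - r)) :
    X (Fin.last (m + 1)) ^ r * rename Fin.castSucc p ∈ IdealN (m + 2) k l r := by
  induction hp using Submodule.span_induction with
  | mem p hp =>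
    obtain ((⟨h, rfl⟩ | ⟨h, rfl⟩) | ⟨i, h₁, h₂, rfl⟩) := hp
    · rw [map_pow, rename_X]
      exact Ideal.mul_mem_left _ _ (X_zero_pow_mem (m + 1) k l r)
    · rw [map_pow, rename_X]
      exact X_last_pow_mul_X_pow_mem m k l r hr
    · exact X_last_pow_mul_powerCoeff_mem h₁ h₂
  | zero => simp
  | add p q _ _ hp hq => rw [map_add, mul_add]; exact Ideal.add_mem _ hp hq
  | smul a p _ hp =>
    rw [smul_eq_mul, map_mul, mul_left_comm]
    exact Ideal.mul_mem_left _ _ hp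

lemma finrank_Dspace_le (m k l r : ℕ) (hr1 : 1 ≤ r) (hr : r ≤ k) :
    Module.finrank ℂ (Dspace (m + 2) k l r) ≤
      Module.finrank ℂ (Dspace (m + 2) k l (r - 1)) +
        Module.finrank ℂ (Dspace (m + 1) k l (k - r)) := by
  let f : Dspace (m + 2) k l r →ₗ[ℂ] Dspace (m + 2) k l (r - 1) :=
    (Ideal.Quotient.factorₐ ℂ (IdealN_le_pred (m + 1) k l r hr1)).toLinearMap
  let π : MvPolynomial (Fin (m + 1)) ℂ →ₗ[ℂ] Dspace (m + 1) k l (k - r) :=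
    (Ideal.Quotient.mkₐ ℂ _).toLinearMap
  let h : MvPolynomial (Fin (m + 1)) ℂ →ₗ[ℂ] Dspace (m + 2) k l r :=
    (Ideal.Quotient.mkₐ ℂ _).toLinearMap ∘ₗ LinearMap.mulLeft ℂ (X (Fin.last (m + 1)) ^ r) ∘ₗ
      (rename Fin.castSucc).toLinearMap
  obtain ⟨s, hs⟩ := π.exists_rightInverse_of_surjective
    (LinearMap.range_eq_top.2 Ideal.Quotient.mk_surjective)
  have hker : LinearMap.ker f ≤ LinearMap.range (h ∘ₗ s) := by
    intro x hx
    obtain ⟨q, rfl⟩ := Ideal.Quotient.mk_surjective x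
    have hq : q ∈ IdealN (m + 2) k l (r - 1) := Ideal.Quotient.eq_zero_iff_mem.1 hx
    obtain ⟨a, ha, b, hb, rfl⟩ := Submodule.mem_sup.1 (IdealN_pred_le (m + 1) k l r hr1 hq)
    obtain ⟨c, rfl⟩ := Ideal.mem_span_singleton.1 hb
    obtain ⟨p, d, rfl⟩ := exists_rename_castSucc_add c
    refine ⟨π p, ?_⟩
    have hsp : s (π p) - p ∈ IdealN (m + 1) k l (k - r) :=
      Ideal.Quotient.eq.1 (LinearMap.congr_fun hs (π p))
    refine Ideal.Quotient.eq.2 ?_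
    change X (Fin.last (m + 1)) ^ r * rename Fin.castSucc (s (π p)) - _ ∈ _
    have h₁ := X_last_pow_mul_rename_mem hr hsp
    have h₂ : X (Fin.last (m + 1)) ^ r * (X (Fin.last (m + 1)) * d) ∈ IdealN (m + 2) k l r :=
      X_last_pow_mul_mem (Dvd.intro _ rfl)
    convert Ideal.sub_mem _ (Ideal.sub_mem _ h₁ ha) h₂ using 1
    rw [map_sub]
    ring
  rw [← f.finrank_range_add_finrank_ker]
  exact Nat.add_le_add (Submodule.finrank_le _)
    ((Submodule.finrank_mono hker).trans (LinearMap.finrank_range_le _))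

theorem dim_recursion_inequality (N k l r : ℕ) (hN : 3 ≤ N) (hk : 1 ≤ k)
    (hl : l ≤ k) (hr1 : 1 ≤ r) (hr : r ≤ k) :
    FiniteDimensional ℂ (Dspace N k l r) ∧
    FiniteDimensional ℂ (Dspace N k l (r - 1)) ∧
    FiniteDimensional ℂ (Dspace (N - 1) k l (k - r)) ∧
    Module.finrank ℂ (Dspace N k l r) ≤
      Module.finrank ℂ (Dspace N k l (r - 1)) + Module.finrank ℂ (Dspace (N - 1) k l (k - r)) := by
  obtain ⟨m, rfl⟩ := Nat.exists_eq_add_of_le' (show 2 ≤ N by omega)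
  exact ⟨inferInstance, inferInstance, inferInstance, finrank_Dspace_le m k l r hr1 hr⟩

end
end

section
/- Let N ≥ 2 and let k, l, r be integers with k > l > 0, k > r > 0, l ≠ r and l + r ≠ k. Let m, n ≥ 0 be integers with m + n ≤ N, and if m + n = N assume additionally that (M_{m,n})_m + (M_{m,n})_{m+1} ≤ k. Let P_N(k,l,r) = { x ∈ ℝ^N : x_i ≥ 0 for all i, x_1 ≤ l, x_N ≤ r, x_i + x_{i+1} ≤ k for 1 ≤ i < N }, and let C(M_{m,n}) ⊆ ℝ^N be the tangent cone of P_N(k,l,r) at M_{m,n}, that is, the set of x ∈ ℝ^N satisfying exactly those defining inequalities of P_N(k,l,r) that hold with equality at the point M_{m,n}. Then C(M_{m,n}) ∩ ℤ^N = M_{m,n} + { ∑_{i=1}^N c_i v^i : c_1,…,c_N ∈ ℤ_{≥0} }, where v^1,…,v^N ∈ ℤ^N are defined as follows: for i ≤ m, v^i has j-th coordinate (−1)^{j−m+i} for m−i < j ≤ m and 0 otherwise; for m < i ≤ N−n, v^i is the i-th standard basis vector; for i > N−n, v^i has (N−n+s)-th coordinate (−1)^{N−i+2−s} for 1 ≤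 s ≤ N−i+1 and all other coordinates 0. -/
/-!
STATEMENT 6: description of the integer points of the tangent cone of the
polyhedron P_N(k,l,r) at a simple vertex M_{m,n}, for generic k, l, r.
Coordinates are 1-indexed in the paper; here `j : Fin N` corresponds to the
coordinate `j.1 + 1`.
-/

noncomputable section

/-- The vertex `M_{m,n}` of `P_N(k,l,r)` (the coordinate `j` is 1-indexed as `j.1+1`). -/
def Mvec (N : ℕ) (k l r : ℤ) (m n : ℕ) (j : Fin N) : ℤ :=
  if j.1 + 1 ≤ m then (if (j.1 + 1) % 2 = 1 then l else k - l)
  else if N - n < j.1 + 1 then (if (N - j.1) % 2 = 1 then r else k - r)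
  else 0

/-- The generators `v^1, …, v^N` of the tangent cone at `M_{m,n}`:
`vvec N m n i j` is the `(j.1+1)`-th coordinate of `v^{i.1+1}`. -/
def vvec (N m n : ℕ) (i j : Fin N) : ℤ :=
  if i.1 + 1 ≤ m then
    (if m - (i.1 + 1) < j.1 + 1 ∧ j.1 + 1 ≤ m then (-1 : ℤ) ^ ((j.1 + 1) + (i.1 + 1) - m) else 0)
  else if i.1 + 1 ≤ N - n then (if j = i then 1 else 0)
  else
    (if N - n < j.1 + 1 ∧ j.1 + 1 ≤ N - n + (N - (i.1 + 1) + 1) then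
      (-1 : ℤ) ^ (N - (i.1 + 1) + 2 - ((j.1 + 1) - (N - n))) else 0)

/-- The tangent cone `C(M_{m,n})` of `P_N(k,l,r)` at the vertex `M_{m,n}`: the set of
points of `ℝ^N` satisfying exactly those defining inequalities of `P_N(k,l,r)` that
are equalities at `M_{m,n}`. -/
def coneAt (N : ℕ) (k l r : ℤ) (m n : ℕ) : Set (Fin N → ℝ) :=
  {x | (∀ i : Fin N, Mvec N k l r m n i = 0 → 0 ≤ x i) ∧
       (∀ h : 0 < N, Mvec N k l r m n ⟨0, h⟩ = l → x ⟨0, h⟩ ≤ (l : ℝ)) ∧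
       (∀ h : 0 < N, Mvec N k l r m n ⟨N - 1, Nat.sub_lt h Nat.one_pos⟩ = r →
          x ⟨N - 1, Nat.sub_lt h Nat.one_pos⟩ ≤ (r : ℝ)) ∧
       (∀ (t : Fin N) (h : t.1 + 1 < N),
          Mvec N k l r m n t + Mvec N k l r m n ⟨t.1 + 1, h⟩ = k →
          x t + x ⟨t.1 + 1, h⟩ ≤ (k : ℝ))}

/-- The linear functional dual to `vvec N m n i`, evaluated at a vector indexed from `0`
and extended by zero. -/
def dualFunctional (N m n i : ℕ) (y : ℕ → ℤ) : ℤ :=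
  if i + 1 ≤ m then -(y (m - 1 - i) + (if m - 1 - i = 0 then 0 else y (m - 1 - i - 1)))
  else if i + 1 ≤ N - n then y i
  else -(y (N - 1 - (i - (N - n))) + y (N - 1 - (i - (N - n)) + 1))

/-- Extension by zero of a vector to all natural indices. -/
def extendZero {N : ℕ} (y : Fin N → ℤ) (j : ℕ) : ℤ := if h : j < N then y ⟨j, h⟩ else 0

lemma extendZero_of_lt {N : ℕ} (y : Fin N → ℤ) {j : ℕ} (h : j < N) :
    extendZero y j = y ⟨j, h⟩ := dif_pos h

lemma extendZero_of_le {N : ℕ} (y : Fin N → ℤ) {j : ℕ} (h : N ≤ j) :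
    extendZero y j = 0 := dif_neg (by omega)

lemma extendZero_sub {N : ℕ} (y z : Fin N → ℤ) (j : ℕ) :
    extendZero (y - z) j = extendZero y j - extendZero z j := by
  unfold extendZero; split <;> simp

lemma extendZero_sum {N : ℕ} {ι : Type*} [Fintype ι] (c : ι → ℤ) (v : ι → Fin N → ℤ) (j : ℕ) :
    extendZero (fun j => ∑ i, c i * v i j) j = ∑ i, c i * extendZero (v i) j := by
  unfold extendZero; split <;> simp

lemma dualFunctional_sub (N m n i : ℕ) (y z : ℕ → ℤ) :
    dualFunctional N m n i (fun j => y j - z j) =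
      dualFunctional N m n i y - dualFunctional N m n i z := by
  unfold dualFunctional; split_ifs <;> ring

lemma dualFunctional_sum (N m n i : ℕ) {ι : Type*} [Fintype ι] (c : ι → ℤ) (v : ι → ℕ → ℤ) :
    dualFunctional N m n i (fun j => ∑ a, c a * v a j) =
      ∑ a, c a * dualFunctional N m n i (v a) := by
  unfold dualFunctional
  split_ifs <;> simp [mul_add, Finset.sum_add_distrib]

lemma extendZero_vvec {N m n : ℕ} (hmn : m + n ≤ N) (i : Fin N) (j : ℕ) :
    extendZero (vvec N m n i) j =
      if i.1 < m then
        (if m - 1 - i.1 ≤ j ∧ j < m then (-1 : ℤ) ^ (j - (m - 1 - i.1) + 1) else 0)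
      else if i.1 < N - n then (if j = i then 1 else 0)
      else
        (if N - n ≤ j ∧ j ≤ N - 1 - (i.1 - (N - n)) then
          (-1 : ℤ) ^ (N - 1 - (i.1 - (N - n)) - j + 1) else 0) := by
  have hi := i.2
  unfold extendZero vvec
  simp only [Fin.ext_iff]
  split_ifs <;> first | rfl | (exfalso; omega) | (congr 1; omega)

lemma dualFunctional_vvec {N m n : ℕ} (hmn : m + n ≤ N) (i a : Fin N) :
    dualFunctional N m n i (extendZero (vvec N m n a)) = if a = i then 1 else 0 := by
  have hi := i.2
  have ha := a.2
  unfold dualFunctional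
  simp only [extendZero_vvec hmn, Fin.ext_iff]
  by_cases hai : a.1 = i.1
  · rw [if_pos hai, hai]
    split_ifs <;> first | (exfalso; omega) | simp
  rw [if_neg hai]
  split_ifs <;> first | (exfalso; omega) | rfl | skip
  · rw [show m - 1 - i.1 - (m - 1 - a.1) + 1 = m - 1 - i.1 - 1 - (m - 1 - a.1) + 1 + 1 by omega,
      pow_succ _ (m - 1 - i.1 - 1 - (m - 1 - a.1) + 1)]
    ring
  · rw [show N - 1 - (a.1 - (N - n)) - (N - 1 - (i.1 - (N - n))) + 1 =
        N - 1 - (a.1 - (N - n)) - (N - 1 - (i.1 - (N - n)) + 1) + 1 + 1 by omega,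
      pow_succ _ (N - 1 - (a.1 - (N - n)) - (N - 1 - (i.1 - (N - n)) + 1) + 1)]
    ring

lemma dualFunctional_injective {N m n : ℕ} (hmn : m + n ≤ N) (z : ℕ → ℤ) (hzN : z N = 0)
    (hz : ∀ i < N, dualFunctional N m n i z = 0) : ∀ j < N, z j = 0 := by
  have left : ∀ j < m, z j = 0 := by
    intro j
    induction j with
    | zero =>
      intro hj
      have := hz (m - 1) (by omega)
      rw [dualFunctional, if_pos (by omega), if_pos (by omega)] at this
      rw [show m - 1 - (m - 1) = 0 by omega] at this
      omega
    | succ j ih =>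
      intro hj
      have := hz (m - 1 - (j + 1)) (by omega)
      rw [dualFunctional, if_pos (by omega), if_neg (by omega),
        show m - 1 - (m - 1 - (j + 1)) = j + 1 by omega, Nat.add_sub_cancel,
        ih (by omega)] at this
      omega
  have right : ∀ s ≤ n, z (N - s) = 0 := by
    intro s
    induction s with
    | zero => intro _; exact hzN
    | succ s ih =>
      intro hs
      have := hz (N - n + s) (by omega)
      rw [dualFunctional, if_neg (by omega), if_neg (by omega),
        show N - 1 - (N - n + s - (N - n)) = N - (s + 1) by omega,
        show N - (s + 1) + 1 = N - s by omega, ih (by omega)] at this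
      omega
  intro j hj
  by_cases h1 : j < m
  · exact left j h1
  by_cases h2 : j < N - n
  · have := hz j hj
    rwa [dualFunctional, if_neg (by omega), if_pos (by omega)] at this
  · have := right (N - j) (by omega)
    rwa [show N - (N - j) = j by omega] at this

lemma exists_natCombination_iff {N m n : ℕ} (hmn : m + n ≤ N) (y : Fin N → ℤ) :
    (∃ c : Fin N → ℕ, ∀ j, y j = ∑ i, (c i : ℤ) * vvec N m n i j) ↔
      ∀ i : Fin N, 0 ≤ dualFunctional N m n i (extendZero y) := by
  have key (c : Fin N → ℤ) (i : Fin N) :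
      dualFunctional N m n i (extendZero fun j => ∑ a, c a * vvec N m n a j) = c i := by
    rw [funext (extendZero_sum c (vvec N m n)), dualFunctional_sum]
    simp [dualFunctional_vvec hmn]
  constructor
  · rintro ⟨c, hc⟩ i
    rw [funext hc, key]
    positivity
  · intro h
    refine ⟨fun i => (dualFunctional N m n i (extendZero y)).toNat, fun j => ?_⟩
    simp only [Int.toNat_of_nonneg (h _)]
    set w : Fin N → ℤ :=
      fun j => ∑ i : Fin N, dualFunctional N m n i (extendZero y) * vvec N m n i j with hw
    have h0 := dualFunctional_injective hmn (extendZero (y - w)) (extendZero_of_le _ le_rfl)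
      (fun i hi => by
        rw [funext (extendZero_sub y w), dualFunctional_sub,
          key (fun i => dualFunctional N m n i (extendZero y)) ⟨i, hi⟩, sub_self]) j j.2
    rw [extendZero_of_lt _ j.2] at h0
    exact sub_eq_zero.mp h0

lemma intCast_mem_coneAt_iff {N : ℕ} {k l r : ℤ}
    (hl0 : 0 < l) (hlk : l < k) (hr0 : 0 < r) (hrk : r < k)
    (hlr : l ≠ r) (hlrk : l + r ≠ k) {m n : ℕ} (hmn : m + n ≤ N) (x : Fin N → ℤ) :
    ((fun i => (x i : ℝ)) ∈ coneAt N k l r m n) ↔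
      ∀ i : Fin N, 0 ≤ dualFunctional N m n i (extendZero (x - Mvec N k l r m n)) := by
  simp only [coneAt, Set.mem_ofPred_eq]
  norm_cast
  constructor
  · rintro ⟨hz, hl, hr, hp⟩ i
    have hi := i.2
    unfold dualFunctional
    split_ifs with h1 h2 h3
    · have := hl (by omega) (by simp [Mvec]; omega)
      rw [h2, extendZero_of_lt _ (by omega)]
      have e : Mvec N k l r m n ⟨0, by omega⟩ = l := by simp [Mvec]; omega
      rw [Pi.sub_apply, e]
      omega
    · have e : Mvec N k l r m n ⟨m - 1 - i - 1, by omega⟩ +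
          Mvec N k l r m n ⟨m - 1 - i - 1 + 1, by omega⟩ = k := by
        simp only [Mvec]; split_ifs <;> omega
      have := hp ⟨m - 1 - i - 1, by omega⟩ (by simp only; omega) e
      obtain ⟨p, hpe⟩ : ∃ p, m - 1 - i.1 = p + 1 := ⟨m - 1 - i - 1, by omega⟩
      simp only [hpe, Nat.add_sub_cancel] at *
      rw [extendZero_of_lt _ (by omega), extendZero_of_lt _ (by omega), Pi.sub_apply, Pi.sub_apply]
      omega
    · have e : Mvec N k l r m n i = 0 := by simp only [Mvec]; split_ifs <;> omega
      rw [extendZero_of_lt _ hi, Pi.sub_apply, Fin.eta, e]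
      have := hz i e
      omega
    · obtain ⟨q, hq⟩ : ∃ q, N - 1 - (i.1 - (N - n)) = q := ⟨_, rfl⟩
      rw [hq, extendZero_of_lt _ (by omega)]
      by_cases h : q + 1 < N
      · have e : Mvec N k l r m n ⟨q, by omega⟩ + Mvec N k l r m n ⟨q + 1, h⟩ = k := by
          simp only [Mvec]; split_ifs <;> omega
        have : x ⟨q, by omega⟩ + x ⟨q + 1, h⟩ ≤ k := hp ⟨q, by omega⟩ h e
        rw [extendZero_of_lt _ h, Pi.sub_apply, Pi.sub_apply]
        omega
      · obtain rfl : q = N - 1 := by omega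
        have e : Mvec N k l r m n ⟨N - 1, by omega⟩ = r := by
          simp only [Mvec]; split_ifs <;> omega
        have := hr (by omega) e
        rw [extendZero_of_le _ (by omega), Pi.sub_apply, e]
        omega
  · intro h
    refine ⟨fun i e => ?_, fun h0 e => ?_, fun h0 e => ?_, fun t ht e => ?_⟩
    · have hi := h i
      have h1 : ¬ i.1 + 1 ≤ m := by
        intro h1
        simp only [Mvec] at e; split_ifs at e <;> omega
      have h2 : i.1 + 1 ≤ N - n := by
        simp only [Mvec] at e; split_ifs at e <;> omega
      rw [dualFunctional, if_neg h1, if_pos h2, extendZero_of_lt _ i.2, Pi.sub_apply, Fin.eta,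
        e] at hi
      omega
    · have h1 : 1 ≤ m := by
        simp only [Mvec] at e; split_ifs at e <;> omega
      have hi := h ⟨m - 1, by omega⟩
      rw [dualFunctional, if_pos (by simp only; omega), if_pos (by simp only; omega)] at hi
      simp only [Nat.sub_self] at hi
      rw [extendZero_of_lt _ h0, Pi.sub_apply, e] at hi
      omega
    · have h1 : 1 ≤ n := by
        simp only [Mvec] at e; split_ifs at e <;> omega
      have hi := h ⟨N - n, by omega⟩
      rw [dualFunctional, if_neg (by simp only; omega), if_neg (by simp only; omega)] at hi
      simp only [Nat.sub_self, Nat.sub_zero] at hi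
      rw [extendZero_of_lt _ (by omega), extendZero_of_le _ (by omega), Pi.sub_apply, e] at hi
      omega
    · have h1 : t.1 + 1 < m ∨ N - n ≤ t.1 := by
        simp only [Mvec] at e; split_ifs at e <;> omega
      have ht' := t.2
      rcases h1 with h1 | h1
      · have hi := h ⟨m - 1 - (t.1 + 1), by omega⟩
        rw [dualFunctional, if_pos (by simp only; omega), if_neg (by simp only; omega)] at hi
        simp only [show m - 1 - (m - 1 - (t.1 + 1)) = t.1 + 1 by omega, Nat.add_sub_cancel] at hi
        rw [extendZero_of_lt _ ht, extendZero_of_lt _ ht', Pi.sub_apply, Pi.sub_apply,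
          Fin.eta] at hi
        omega
      · have hi := h ⟨N - 1 - t.1 + (N - n), by omega⟩
        rw [dualFunctional, if_neg (by simp only; omega), if_neg (by simp only; omega)] at hi
        simp only [show N - 1 - (N - 1 - t.1 + (N - n) - (N - n)) = t.1 by omega] at hi
        rw [extendZero_of_lt _ ht, extendZero_of_lt _ ht', Pi.sub_apply, Pi.sub_apply,
          Fin.eta] at hi
        omega

theorem tangent_cone_lattice_points (N : ℕ) (hN : 2 ≤ N) (k l r : ℤ)
    (hl0 : 0 < l) (hlk : l < k) (hr0 : 0 < r) (hrk : r < k)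
    (hlr : l ≠ r) (hlrk : l + r ≠ k)
    (m n : ℕ) (hmn : m + n ≤ N)
    (hbd : ∀ (_ : m + n = N) (h1 : 1 ≤ m) (h2 : m < N),
      Mvec N k l r m n ⟨m - 1, by omega⟩ + Mvec N k l r m n ⟨m, h2⟩ ≤ k)
    (x : Fin N → ℤ) :
    ((fun i => (x i : ℝ)) ∈ coneAt N k l r m n) ↔
      ∃ c : Fin N → ℕ, ∀ j : Fin N,
        x j = Mvec N k l r m n j + ∑ i : Fin N, (c i : ℤ) * vvec N m n i j := by
  rw [intCast_mem_coneAt_iff hl0 hlk hr0 hrk hlr hlrk hmn, ← exists_natCombination_iff hmn]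
  simp only [Pi.sub_apply, sub_eq_iff_eq_add']

end
end

section
/- Let N ≥ 3 be odd and let k ≥ 1, 0 ≤ l ≤ r ≤ k be integers. Then, in the field ℚ(q,z), the lattice-point generating polynomial satisfies p_N(k,l,r;q,z) = d^o_N(k,l,r;q,z). -/
/-!
STATEMENT 7: For odd N ≥ 3 and 1 ≤ k, 0 ≤ l ≤ r ≤ k,
p_N(k,l,r;q,z) = d^o_N(k,l,r;q,z) in ℚ(q,z).
-/

open MvPolynomial

noncomputable section

/-- The field `ℚ(q,z)` of rational functions in two variables. -/
abbrev K := FractionRing (MvPolynomial (Fin 2) ℚ)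

/-- The variable `q` as an element of `ℚ(q,z)`. -/
def qK : K := algebraMap (MvPolynomial (Fin 2) ℚ) K (X 0)

/-- The variable `z` as an element of `ℚ(q,z)`. -/
def zK : K := algebraMap (MvPolynomial (Fin 2) ℚ) K (X 1)

def phiQ (N : ℕ) (a : Fin N → ℤ) : ℤ := ∑ t : Fin N, (t.1 + 1 : ℤ) * a t
def phiZ (N : ℕ) (a : Fin N → ℤ) : ℤ := ∑ t : Fin N, a t

/-- The contribution `d^{m,n}_N(k,l,r;q,z)` of the vertex `M_{m,n}`, in `ℚ(q,z)`. -/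
def dmn (N : ℕ) (k l r : ℤ) (m n : ℕ) : K :=
  qK ^ phiQ N (Mvec N k l r m n) * zK ^ phiZ N (Mvec N k l r m n) /
    ((∏ i ∈ Finset.Icc 1 (m / 2), (1 - qK ^ (i : ℤ))) *
     (∏ i ∈ Finset.Icc (m / 2 + 1) m, (1 - qK ^ (-(i : ℤ)) * zK⁻¹)) *
     (∏ i ∈ Finset.Icc (m + 1) (N - n), (1 - qK ^ (i : ℤ) * zK)) *
     (∏ i ∈ Finset.Icc 1 (n / 2), (1 - qK ^ (-(i : ℤ)))) *
     (∏ i ∈ Finset.Icc (n / 2 + 1) n, (1 - qK ^ ((i : ℤ) - N - 1) * zK⁻¹)))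

/-- `d^e_N(k,l,r;q,z)`: sum of `d^{m,n}_N` over `m, n ≥ 0` with `m+n < N`, or
`m+n = N` and `m` even. -/
def dE (N : ℕ) (k l r : ℤ) : K :=
  ∑ p ∈ (Finset.range (N + 1) ×ˢ Finset.range (N + 1)).filter
      (fun p => p.1 + p.2 < N ∨ (p.1 + p.2 = N ∧ Even p.1)),
    dmn N k l r p.1 p.2

/-- `d^o_N(k,l,r;q,z)`: sum of `d^{m,n}_N` over `m, n ≥ 0` with `m+n < N`, or
`m+n = N` and `m` odd. -/
def dO (N : ℕ) (k l r : ℤ) : K :=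
  ∑ p ∈ (Finset.range (N + 1) ×ˢ Finset.range (N + 1)).filter
      (fun p => p.1 + p.2 < N ∨ (p.1 + p.2 = N ∧ Odd p.1)),
    dmn N k l r p.1 p.2

/-- The set `A_N(k,l,r)` of lattice points of the polyhedron `P_N(k,l,r)`. -/
def ASet (N : ℕ) (k l r : ℤ) : Set (Fin N → ℤ) :=
  {a | (∀ i, 0 ≤ a i) ∧
       (∀ h : 0 < N, a ⟨0, h⟩ ≤ l) ∧
       (∀ h : 0 < N, a ⟨N - 1, Nat.sub_lt h Nat.one_pos⟩ ≤ r) ∧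
       (∀ (t : Fin N) (h : t.1 + 1 < N), a t + a ⟨t.1 + 1, h⟩ ≤ k)}

/-- The lattice-point generating polynomial `p_N(k,l,r;q,z) = ∑_{a ∈ A_N(k,l,r)}
q^{φ_q(a)} z^{φ_z(a)}`, regarded as an element of `ℚ(q,z)` (the set `A_N(k,l,r)`
is finite, and `∑ᶠ` is the sum over it). -/
def pPoly (N : ℕ) (k l r : ℤ) : K :=
  ∑ᶠ a ∈ ASet N k l r, qK ^ phiQ N a * zK ^ phiZ N a

/-- The specialization of the monomial `q^{φ_q(v)} z^{φ_z(v)}` in a field. -/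
def latticeMonomial {F : Type*} [Field F] (q z : F) (N : ℕ) (v : Fin N → ℤ) : F :=
  q ^ phiQ N v * z ^ phiZ N v

/-- The denominator of the contribution of the vertex `M_{m,n}`. -/
def vertexDenom {F : Type*} [Field F] (q z : F) (N m n : ℕ) : F :=
  (∏ i ∈ Finset.Icc 1 (m / 2), (1 - q ^ (i : ℤ))) *
     (∏ i ∈ Finset.Icc (m / 2 + 1) m, (1 - q ^ (-(i : ℤ)) * z⁻¹)) *
     (∏ i ∈ Finset.Icc (m + 1) (N - n), (1 - q ^ (i : ℤ) * z)) *
     (∏ i ∈ Finset.Icc 1 (n / 2), (1 - q ^ (-(i : ℤ)))) *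
     (∏ i ∈ Finset.Icc (n / 2 + 1) n, (1 - q ^ ((i : ℤ) - N - 1) * z⁻¹))

/-- The contribution of the vertex `M_{m,n}`, with `q` and `z` specialized to a field. -/
def vertexTerm {F : Type*} [Field F] (q z : F) (N : ℕ) (k l r : ℤ) (m n : ℕ) : F :=
  latticeMonomial q z N (Mvec N k l r m n) / vertexDenom q z N m n

/-- The pair `(q, z)` avoids every zero of the denominators. -/
structure IsGenericPair {F : Type*} [Field F] (q z : F) : Prop where
  q_ne_zero : q ≠ 0
  z_ne_zero : z ≠ 0
  zpow_ne_one : ∀ i : ℤ, i ≠ 0 → q ^ i ≠ 1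
  zpow_mul_ne_one : ∀ i : ℤ, q ^ i * z ≠ 1

/-- The ratio of the vertex monomials for `l - 1` and `l`. -/
def shiftRatio {F : Type*} [Field F] (q z : F) (m : ℕ) : F :=
  if m % 2 = 0 then q ^ ((m / 2 : ℕ) : ℤ) else q ^ (-((m / 2 : ℕ) : ℤ) - 1) * z⁻¹

namespace IsGenericPair

variable {F : Type*} [Field F] {q z : F}

theorem mul (h : IsGenericPair q z) : IsGenericPair q (q * z) where
  q_ne_zero := h.q_ne_zero
  z_ne_zero := mul_ne_zero h.q_ne_zero h.z_ne_zero
  zpow_ne_one := h.zpow_ne_one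
  zpow_mul_ne_one i := by
    rw [← mul_assoc, ← zpow_add_one₀ h.q_ne_zero]
    exact h.zpow_mul_ne_one _

theorem reflect (h : IsGenericPair q z) (j : ℤ) : IsGenericPair q⁻¹ (q ^ j * z) where
  q_ne_zero := inv_ne_zero h.q_ne_zero
  z_ne_zero := mul_ne_zero (zpow_ne_zero _ h.q_ne_zero) h.z_ne_zero
  zpow_ne_one i hi := by
    rw [inv_zpow']
    exact h.zpow_ne_one _ (by omega)
  zpow_mul_ne_one i := by
    rw [inv_zpow', ← mul_assoc, ← zpow_add₀ h.q_ne_zero]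
    exact h.zpow_mul_ne_one _

theorem one_sub_zpow_ne_zero (h : IsGenericPair q z) {i : ℤ} (hi : i ≠ 0) : 1 - q ^ i ≠ 0 :=
  sub_ne_zero.2 (h.zpow_ne_one i hi).symm

theorem one_sub_zpow_mul_ne_zero (h : IsGenericPair q z) (i : ℤ) : 1 - q ^ i * z ≠ 0 :=
  sub_ne_zero.2 (h.zpow_mul_ne_one i).symm

theorem one_sub_zpow_mul_inv_ne_zero (h : IsGenericPair q z) (i : ℤ) :
    1 - q ^ i * z⁻¹ ≠ 0 := by
  intro h0
  apply h.zpow_mul_ne_one (-i)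
  rw [zpow_neg]
  have h1 : q ^ i * z⁻¹ = 1 := (sub_eq_zero.1 h0).symm
  have h2 : (q ^ i * z⁻¹)⁻¹ = 1 := by rw [h1, inv_one]
  rwa [mul_inv, inv_inv] at h2

theorem vertexDenom_ne_zero (h : IsGenericPair q z) (N m n : ℕ) :
    vertexDenom q z N m n ≠ 0 := by
  refine mul_ne_zero (mul_ne_zero (mul_ne_zero (mul_ne_zero ?_ ?_) ?_) ?_) ?_ <;>
    refine Finset.prod_ne_zero_iff.2 fun i hi => ?_ <;> rw [Finset.mem_Icc] at hi
  · exact h.one_sub_zpow_ne_zero (by omega)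
  · exact h.one_sub_zpow_mul_inv_ne_zero _
  · exact h.one_sub_zpow_mul_ne_zero _
  · exact h.one_sub_zpow_ne_zero (by omega)
  · exact h.one_sub_zpow_mul_inv_ne_zero _

theorem latticeMonomial_ne_zero (h : IsGenericPair q z) (N : ℕ) (v : Fin N → ℤ) :
    latticeMonomial q z N v ≠ 0 :=
  mul_ne_zero (zpow_ne_zero _ h.q_ne_zero) (zpow_ne_zero _ h.z_ne_zero)

theorem shiftRatio_ne_zero (h : IsGenericPair q z) (m : ℕ) : shiftRatio q z m ≠ 0 := by
  unfold shiftRatio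
  split_ifs
  · exact zpow_ne_zero _ h.q_ne_zero
  · exact mul_ne_zero (zpow_ne_zero _ h.q_ne_zero) (inv_ne_zero h.z_ne_zero)

theorem one_sub_shiftRatio_ne_zero (h : IsGenericPair q z) (m : ℕ) :
    1 - shiftRatio q z (m + 1) ≠ 0 := by
  unfold shiftRatio
  split_ifs
  · exact h.one_sub_zpow_ne_zero (by omega)
  · exact h.one_sub_zpow_mul_inv_ne_zero _

theorem shiftRatio_succ (h : IsGenericPair q z) (m : ℕ) :
    q * z * shiftRatio q z (m + 1) * shiftRatio q (q * z) m = 1 := by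
  have hq := h.q_ne_zero
  have hz := h.z_ne_zero
  unfold shiftRatio
  rcases Nat.even_or_odd' m with ⟨a, rfl | rfl⟩
  · rw [if_neg (by omega), if_pos (by omega), show (2 * a + 1) / 2 = a by omega,
      show 2 * a / 2 = a by omega, sub_eq_add_neg, zpow_add₀ hq, zpow_neg, zpow_neg_one]
    field_simp
  · rw [if_pos (by omega), if_neg (by omega), show (2 * a + 1 + 1) / 2 = a + 1 by omega,
      show (2 * a + 1) / 2 = a by omega, sub_eq_add_neg, zpow_add₀ hq, zpow_neg, zpow_neg_one,
      Nat.cast_add, Nat.cast_one, zpow_add_one₀ hq]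
    field_simp

end IsGenericPair

theorem phiQ_cons (N : ℕ) (a : ℤ) (v : Fin N → ℤ) :
    phiQ (N + 1) (Fin.cons a v) = a + (phiQ N v + phiZ N v) := by
  unfold phiQ phiZ
  rw [Fin.sum_univ_succ, ← Finset.sum_add_distrib]
  simp [add_mul]

theorem phiZ_cons (N : ℕ) (a : ℤ) (v : Fin N → ℤ) :
    phiZ (N + 1) (Fin.cons a v) = a + phiZ N v := by
  unfold phiZ
  rw [Fin.sum_univ_succ]
  simp

theorem latticeMonomial_cons {F : Type*} [Field F] {q z : F} (h : IsGenericPair q z) (N : ℕ)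
    (a : ℤ) (v : Fin N → ℤ) :
    latticeMonomial q z (N + 1) (Fin.cons a v) = (q * z) ^ a * latticeMonomial q (q * z) N v := by
  unfold latticeMonomial
  rw [phiQ_cons, phiZ_cons, zpow_add₀ h.q_ne_zero, zpow_add₀ h.q_ne_zero, zpow_add₀ h.z_ne_zero,
    mul_zpow, mul_zpow]
  ring

theorem Mvec_succ_left {N n : ℕ} (k l r : ℤ) (m : ℕ) (hn : n ≤ N) :
    Mvec (N + 1) k l r (m + 1) n = Fin.cons l (Mvec N k (k - l) r m n) := by
  funext j
  refine Fin.cases ?_ (fun j => ?_) j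
  · simp [Mvec]
  · rw [Fin.cons_succ]
    simp only [Mvec, Fin.val_succ]
    have := j.2
    split_ifs <;> omega

theorem Mvec_zero_left {N n : ℕ} (k l l' r : ℤ) (hn : n ≤ N) :
    Mvec (N + 1) k l r 0 n = Fin.cons 0 (Mvec N k l' r 0 n) := by
  funext j
  refine Fin.cases ?_ (fun j => ?_) j
  · simp only [Mvec, Fin.cons_zero, Fin.val_zero]
    split_ifs <;> omega
  · rw [Fin.cons_succ]
    simp only [Mvec, Fin.val_succ]
    have := j.2
    split_ifs <;> omega

theorem Mvec_zero_left_congr (N n : ℕ) (k l l' r : ℤ) :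
    Mvec N k l r 0 n = Mvec N k l' r 0 n := by
  funext j
  simp [Mvec]

theorem latticeMonomial_Mvec_sub_one {F : Type*} [Field F] {q z : F} (h : IsGenericPair q z)
    {N m n : ℕ} (k l r : ℤ) (hmn : m + n ≤ N) :
    latticeMonomial q z N (Mvec N k (l - 1) r m n) =
      latticeMonomial q z N (Mvec N k l r m n) * shiftRatio q z m := by
  induction m generalizing N l z with
  | zero => simp [shiftRatio, Mvec_zero_left_congr N n k (l - 1) l r]
  | succ m ih =>
    obtain ⟨N, rfl⟩ : ∃ N', N = N' + 1 := ⟨N - 1, by omega⟩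
    have hn : n ≤ N := by omega
    rw [Mvec_succ_left _ _ _ _ hn, Mvec_succ_left _ _ _ _ hn, latticeMonomial_cons h,
      latticeMonomial_cons h]
    have h1 := ih h.mul (l := k - (l - 1)) (N := N) (by omega)
    rw [show k - (l - 1) - 1 = k - l by ring] at h1
    have h2 := h.shiftRatio_succ m
    rw [h1, zpow_sub_one₀ h.mul.z_ne_zero]
    rw [inv_eq_of_mul_eq_one_right (b := shiftRatio q z (m + 1) * shiftRatio q (q * z) m)
      (by rw [← h2]; ring)]
    ring

theorem latticeMonomial_Mvec_succ {F : Type*} [Field F] {q z : F} (h : IsGenericPair q z)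
    {N m n : ℕ} (k l r : ℤ) (hmn : m + n < N) :
    latticeMonomial q z N (Mvec N k l r (m + 1) n) =
      latticeMonomial q z N (Mvec N k l r m n) *
        (q ^ ((m : ℤ) + 1) * z) ^ (if m % 2 = 0 then l else k - l) := by
  obtain ⟨N, rfl⟩ : ∃ N', N = N' + 1 := ⟨N - 1, by omega⟩
  have hn : n ≤ N := by omega
  induction m generalizing N l z with
  | zero =>
    rw [Mvec_succ_left _ _ _ _ hn, Mvec_zero_left k l (k - l) r hn, latticeMonomial_cons h,
      latticeMonomial_cons h]
    simp [mul_comm]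
  | succ m ih =>
    obtain ⟨N, rfl⟩ : ∃ N', N = N' + 1 := ⟨N - 1, by omega⟩
    rw [Mvec_succ_left _ _ _ _ hn, Mvec_succ_left _ _ _ _ hn, latticeMonomial_cons h,
      latticeMonomial_cons h, ih h.mul (k - l) N (by omega) (by omega), ← mul_assoc]
    congr 2
    · rw [Nat.cast_add, Nat.cast_one, zpow_add_one₀ h.q_ne_zero ((m : ℤ) + 1)]
      ring
    · split_ifs <;> omega

theorem prod_Icc_add_one {M : Type*} [CommMonoid M] (f : ℕ → M) (a b : ℕ) :
    ∏ i ∈ Finset.Icc a b, f (i + 1) = ∏ i ∈ Finset.Icc (a + 1) (b + 1), f i := by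
  rw [← Finset.map_add_right_Icc, Finset.prod_map]
  rfl

theorem vertexDenom_succ {F : Type*} [Field F] {q z : F} (h : IsGenericPair q z)
    {N m n : ℕ} (hn : n ≤ N) :
    vertexDenom q z (N + 1) (m + 1) n =
      (1 - shiftRatio q z (m + 1)) * vertexDenom q (q * z) N m n := by
  have hq := h.q_ne_zero
  have hz := h.z_ne_zero
  have e2 : ∏ i ∈ Finset.Icc (m / 2 + 1) m, (1 - q ^ (-(i : ℤ)) * (q * z)⁻¹) =
      ∏ i ∈ Finset.Icc (m / 2 + 1 + 1) (m + 1), (1 - q ^ (-(i : ℤ)) * z⁻¹) := by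
    rw [← prod_Icc_add_one (fun i : ℕ => 1 - q ^ (-(i : ℤ)) * z⁻¹)]
    refine Finset.prod_congr rfl fun i _ => ?_
    rw [Nat.cast_add, Nat.cast_one, neg_add, zpow_add₀ hq, zpow_neg_one, mul_inv, mul_assoc]
  have e3 : ∏ i ∈ Finset.Icc (m + 1) (N - n), (1 - q ^ (i : ℤ) * (q * z)) =
      ∏ i ∈ Finset.Icc (m + 1 + 1) (N + 1 - n), (1 - q ^ (i : ℤ) * z) := by
    rw [show N + 1 - n = N - n + 1 by omega,
      ← prod_Icc_add_one (fun i : ℕ => 1 - q ^ (i : ℤ) * z)]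
    refine Finset.prod_congr rfl fun i _ => ?_
    rw [Nat.cast_add, Nat.cast_one, zpow_add_one₀ hq, mul_assoc]
  have e5 : ∏ i ∈ Finset.Icc (n / 2 + 1) n, (1 - q ^ ((i : ℤ) - N - 1) * (q * z)⁻¹) =
      ∏ i ∈ Finset.Icc (n / 2 + 1) n, (1 - q ^ ((i : ℤ) - (N + 1 : ℕ) - 1) * z⁻¹) := by
    refine Finset.prod_congr rfl fun i _ => ?_
    rw [show (i : ℤ) - (N + 1 : ℕ) - 1 = ((i : ℤ) - N - 1) - 1 by push_cast; ring,
      zpow_sub_one₀ hq ((i : ℤ) - N - 1), mul_inv, mul_assoc]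
  unfold vertexDenom
  rw [e2, e3, e5]
  rcases Nat.even_or_odd' m with ⟨a, rfl | rfl⟩
  · rw [show (2 * a + 1) / 2 = a by omega, show 2 * a / 2 = a by omega,
      ← Finset.mul_prod_Ioc_eq_prod_Icc (show a + 1 ≤ 2 * a + 1 by omega),
      ← Finset.Icc_add_one_left_eq_Ioc, shiftRatio, if_neg (by omega),
      show (2 * a + 1) / 2 = a by omega, show (-((a + 1 : ℕ) : ℤ)) = -(a : ℤ) - 1 by push_cast; ring]
    ring
  · rw [show (2 * a + 1 + 1) / 2 = a + 1 by omega, show (2 * a + 1) / 2 = a by omega,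
      Finset.prod_Icc_succ_top (show 1 ≤ a + 1 by omega), shiftRatio, if_pos (by omega),
      show (2 * a + 1 + 1) / 2 = a + 1 by omega]
    ring

theorem vertexTerm_sub {F : Type*} [Field F] {q z : F} (h : IsGenericPair q z)
    {N m n : ℕ} (k l r : ℤ) (hmn : m + n ≤ N) :
    vertexTerm q z (N + 1) k l r (m + 1) n - vertexTerm q z (N + 1) k (l - 1) r (m + 1) n =
      (q * z) ^ l * vertexTerm q (q * z) N k (k - l) r m n := by
  unfold vertexTerm
  have h1 := h.one_sub_shiftRatio_ne_zero m
  have h2 := h.mul.vertexDenom_ne_zero N m n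
  rw [latticeMonomial_Mvec_sub_one h k l r (by omega), vertexDenom_succ h (by omega),
    Mvec_succ_left _ _ _ _ (by omega), latticeMonomial_cons h]
  field_simp

theorem vertexTerm_zero_left_congr {F : Type*} [Field F] (q z : F) (N n : ℕ) (k l l' r : ℤ) :
    vertexTerm q z N k l r 0 n = vertexTerm q z N k l' r 0 n := by
  rw [vertexTerm, vertexTerm, Mvec_zero_left_congr]

theorem vertexDenom_odd {F : Type*} [Field F] (q z : F) {N a n : ℕ} (hn : 2 * a + n < N) :
    vertexDenom q z N (2 * a + 1) n * (1 - q ^ (2 * a + 1 : ℤ) * z) =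
      vertexDenom q z N (2 * a) n * (1 - q ^ (-(2 * a + 1 : ℤ)) * z⁻¹) := by
  unfold vertexDenom
  rw [show (2 * a + 1) / 2 = a by omega, show 2 * a / 2 = a by omega,
    Finset.prod_Icc_succ_top (show a + 1 ≤ 2 * a + 1 by omega),
    ← Finset.mul_prod_Ioc_eq_prod_Icc (show 2 * a + 1 ≤ N - n by omega),
    ← Finset.Icc_add_one_left_eq_Ioc]
  push_cast
  ring

theorem vertexTerm_neg_one_add {F : Type*} [Field F] {q z : F} (h : IsGenericPair q z)
    {N a n : ℕ} (k r : ℤ) (hn : 2 * a + n < N) :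
    vertexTerm q z N k (-1) r (2 * a) n + vertexTerm q z N k (-1) r (2 * a + 1) n = 0 := by
  unfold vertexTerm
  have h1 := vertexDenom_odd q z hn
  have h2 := h.vertexDenom_ne_zero N (2 * a) n
  have h3 := h.vertexDenom_ne_zero N (2 * a + 1) n
  have h4 := zpow_ne_zero (2 * a + 1 : ℤ) h.q_ne_zero
  have hx := h.one_sub_zpow_mul_ne_zero (2 * a + 1)
  have hz := h.z_ne_zero
  rw [latticeMonomial_Mvec_succ h k (-1) r (by omega), if_pos (by omega), zpow_neg_one]
  rw [zpow_neg] at h1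
  push_cast
  rw [div_add_div _ _ h2 h3, div_eq_zero_iff]
  left
  generalize q ^ (2 * a + 1 : ℤ) = x at *
  generalize vertexDenom q z N (2 * a + 1) n = d at *
  generalize vertexDenom q z N (2 * a) n = e at *
  have h5 : (1 - x * z) * (d + e * (x * z)⁻¹) = 0 := by
    rw [mul_add, mul_comm, h1]
    field_simp
    ring
  linear_combination latticeMonomial q z N (Mvec N k (-1) r (2 * a) n) *
    (mul_eq_zero.1 h5).resolve_left hx

/-- The sum of the vertex contributions over `m + n < N` and over those `m + n = N` with
`m ≡ ε` modulo `2`. -/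
def vertexSum {F : Type*} [Field F] (q z : F) (N ε : ℕ) (k l r : ℤ) : F :=
  ∑ n ∈ Finset.range (N + 1), ∑ m ∈ Finset.range (N + 1),
    if m + n < N ∨ (m + n = N ∧ m % 2 = ε) then vertexTerm q z N k l r m n else 0

/-- The alternating sum of the contributions of the vertices with `m + n = N`. -/
def boundarySum {F : Type*} [Field F] (q z : F) (N : ℕ) (k l r : ℤ) : F :=
  ∑ m ∈ Finset.range (N + 1), (-1) ^ m * vertexTerm q z N k l r m (N - m)

theorem vertexSum_sub {F : Type*} [Field F] {q z : F} (h : IsGenericPair q z)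
    (N : ℕ) {ε : ℕ} (hε : ε ≤ 1) (k l r : ℤ) :
    vertexSum q z (N + 1) ε k l r - vertexSum q z (N + 1) ε k (l - 1) r =
      (q * z) ^ l * vertexSum q (q * z) N (1 - ε) k (k - l) r := by
  unfold vertexSum
  rw [← Finset.sum_sub_distrib, Finset.sum_range_succ, Finset.mul_sum]
  have hlast : ∀ l' : ℤ, ∑ m ∈ Finset.range (N + 1 + 1),
      (if m + (N + 1) < N + 1 ∨ (m + (N + 1) = N + 1 ∧ m % 2 = ε) then
        vertexTerm q z (N + 1) k l' r m (N + 1) else 0) =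
      if 0 = ε then vertexTerm q z (N + 1) k l r 0 (N + 1) else 0 := by
    intro l'
    rw [Finset.sum_range_succ', Finset.sum_eq_zero, zero_add,
      vertexTerm_zero_left_congr q z (N + 1) (N + 1) k l' l r]
    · simp
    · intro m _
      rw [if_neg (by omega)]
  rw [hlast l, hlast (l - 1), sub_self, add_zero]
  refine Finset.sum_congr rfl fun n hn => ?_
  rw [Finset.mem_range] at hn
  rw [← Finset.sum_sub_distrib, Finset.sum_range_succ', Finset.mul_sum,
    vertexTerm_zero_left_congr q z (N + 1) n k (l - 1) l r, sub_self, add_zero]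
  refine Finset.sum_congr rfl fun m _ => ?_
  by_cases hc : m + n < N ∨ (m + n = N ∧ m % 2 = 1 - ε)
  · rw [if_pos (by omega), if_pos (by omega), if_pos hc, vertexTerm_sub h k l r (by omega)]
  · rw [if_neg (by omega), if_neg (by omega), if_neg hc, sub_self, mul_zero]

theorem vertexSum_one_neg_one {F : Type*} [Field F] {q z : F} (h : IsGenericPair q z)
    (N : ℕ) (k r : ℤ) : vertexSum q z N 1 k (-1) r = 0 := by
  unfold vertexSum
  refine Finset.sum_eq_zero fun n _ => ?_
  rw [← Finset.sum_filter]
  refine Finset.sum_involution (fun m _ => if m % 2 = 0 then m + 1 else m - 1) ?_ ?_ ?_ ?_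
  · intro m hm
    rw [Finset.mem_filter, Finset.mem_range] at hm
    rcases Nat.even_or_odd' m with ⟨a, rfl | rfl⟩
    · rw [if_pos (by omega)]
      exact vertexTerm_neg_one_add h k r (by omega)
    · rw [if_neg (by omega), add_comm]
      exact vertexTerm_neg_one_add h k r (by omega)
  · intro m _ _
    split_ifs <;> omega
  · intro m hm
    rw [Finset.mem_filter, Finset.mem_range] at hm ⊢
    split_ifs <;> omega
  · intro m _
    split_ifs <;> omega

theorem vertexSum_zero_sub_one {F : Type*} [Field F] (q z : F) (N : ℕ) (k l r : ℤ) :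
    vertexSum q z N 0 k l r - vertexSum q z N 1 k l r = boundarySum q z N k l r := by
  unfold vertexSum boundarySum
  rw [← Finset.sum_sub_distrib, Finset.sum_congr rfl fun n _ => (Finset.sum_sub_distrib _ _).symm,
    Finset.sum_comm]
  refine Finset.sum_congr rfl fun m hm => ?_
  rw [Finset.mem_range] at hm
  rw [Finset.sum_eq_single (N - m)]
  · rcases Nat.even_or_odd m with he | ho
    · rw [if_pos (by have := Nat.even_iff.1 he; omega),
        if_neg (by have := Nat.even_iff.1 he; omega), he.neg_one_pow]
      ring
    · rw [if_neg (by have := Nat.odd_iff.1 ho; omega),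
        if_pos (by have := Nat.odd_iff.1 ho; omega), ho.neg_one_pow]
      ring
  · intro n _ hne
    split_ifs <;> first | exact sub_self _ | omega
  · intro hN
    exact absurd (Finset.mem_range.2 (by omega)) hN

theorem boundarySum_sub {F : Type*} [Field F] {q z : F} (h : IsGenericPair q z)
    (N : ℕ) (k l r : ℤ) :
    boundarySum q z (N + 1) k l r - boundarySum q z (N + 1) k (l - 1) r =
      -((q * z) ^ l * boundarySum q (q * z) N k (k - l) r) := by
  unfold boundarySum
  rw [← Finset.sum_sub_distrib, Finset.sum_range_succ',
    vertexTerm_zero_left_congr q z (N + 1) _ k (l - 1) l r, sub_self, add_zero, Finset.mul_sum,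
    ← Finset.sum_neg_distrib]
  refine Finset.sum_congr rfl fun m hm => ?_
  rw [Finset.mem_range] at hm
  rw [← mul_sub, show N + 1 - (m + 1) = N - m by omega, vertexTerm_sub h k l r (by omega),
    pow_succ]
  ring

theorem boundarySum_odd_self {F : Type*} [Field F] (q z : F) {N : ℕ} (hN : Odd N) (k l : ℤ) :
    boundarySum q z N k l l = 0 := by
  obtain ⟨c, rfl⟩ := hN
  have key : ∀ a b : ℕ, a + b = c → vertexTerm q z (2 * c + 1) k l l (2 * a) (2 * b + 1) =
      vertexTerm q z (2 * c + 1) k l l (2 * a + 1) (2 * b) := by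
    rintro a b rfl
    unfold vertexTerm
    congr 1
    · congr 1
      funext j
      have := j.2
      simp only [Mvec]
      split_ifs <;> omega
    · unfold vertexDenom
      rw [show (2 * a + 1) / 2 = a by omega, show 2 * a / 2 = a by omega,
        show (2 * b + 1) / 2 = b by omega, show 2 * b / 2 = b by omega,
        Finset.prod_Icc_succ_top (show b + 1 ≤ 2 * b + 1 by omega),
        Finset.prod_Icc_succ_top (show a + 1 ≤ 2 * a + 1 by omega),
        Finset.Icc_eq_empty (show ¬ 2 * a + 1 ≤ 2 * (a + b) + 1 - (2 * b + 1) by omega),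
        Finset.Icc_eq_empty (show ¬ 2 * a + 1 + 1 ≤ 2 * (a + b) + 1 - (2 * b) by omega),
        show ((2 * b + 1 : ℕ) : ℤ) - (2 * (a + b) + 1 : ℕ) - 1 = -((2 * a + 1 : ℕ) : ℤ) by
          push_cast; ring]
      simp only [Finset.prod_empty, mul_one]
      ring
  unfold boundarySum
  refine Finset.sum_involution (fun m _ => if m % 2 = 0 then m + 1 else m - 1) ?_ ?_ ?_ ?_
  · intro m hm
    rw [Finset.mem_range] at hm
    rcases Nat.even_or_odd' m with ⟨a, rfl | rfl⟩
    · rw [if_pos (by omega), show 2 * c + 1 - 2 * a = 2 * (c - a) + 1 by omega,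
        show 2 * c + 1 - (2 * a + 1) = 2 * (c - a) by omega, key a (c - a) (by omega), pow_succ]
      ring
    · rw [if_neg (by omega), show 2 * a + 1 - 1 = 2 * a by omega,
        show 2 * c + 1 - 2 * a = 2 * (c - a) + 1 by omega,
        show 2 * c + 1 - (2 * a + 1) = 2 * (c - a) by omega, key a (c - a) (by omega), pow_succ]
      ring
  · intro m _ _
    split_ifs <;> omega
  · intro m hm
    rw [Finset.mem_range] at hm ⊢
    split_ifs <;> omega
  · intro m _
    split_ifs <;> omega

theorem latticeMonomial_rev {F : Type*} [Field F] {q z : F} (h : IsGenericPair q z) (N : ℕ)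
    (v : Fin N → ℤ) :
    latticeMonomial q⁻¹ (q ^ ((N : ℤ) + 1) * z) N (fun j => v j.rev) = latticeMonomial q z N v := by
  have hZ : phiZ N (fun j => v j.rev) = phiZ N v := Equiv.sum_comp Fin.revPerm v
  have hQ : phiQ N (fun j => v j.rev) = (N + 1) * phiZ N v - phiQ N v := by
    unfold phiQ phiZ
    rw [← Equiv.sum_comp Fin.revPerm, Finset.mul_sum, ← Finset.sum_sub_distrib]
    refine Finset.sum_congr rfl fun j _ => ?_
    dsimp only
    rw [Fin.revPerm_apply, Fin.rev_rev, Fin.val_rev]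
    have := j.2
    push_cast [show j.1 + 1 ≤ N by omega]
    ring
  unfold latticeMonomial
  rw [hZ, hQ, inv_zpow', mul_zpow, ← zpow_mul, ← mul_assoc, ← zpow_add₀ h.q_ne_zero]
  congr 2
  ring

theorem vertexTerm_reflect {F : Type*} [Field F] {q z : F} (h : IsGenericPair q z)
    {N m n : ℕ} (hmn : m + n = N) (k l r : ℤ) :
    vertexTerm q⁻¹ (q ^ ((N : ℤ) + 1) * z) N k r l n m = vertexTerm q z N k l r m n := by
  unfold vertexTerm
  congr 1
  · rw [← latticeMonomial_rev h]
    congr 1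
    funext j
    have := j.2
    simp only [Mvec, Fin.val_rev]
    split_ifs <;> omega
  · unfold vertexDenom
    rw [Finset.Icc_eq_empty (show ¬ n + 1 ≤ N - m by omega),
      Finset.Icc_eq_empty (show ¬ m + 1 ≤ N - n by omega)]
    simp only [inv_zpow', neg_neg, mul_inv, ← zpow_neg, ← mul_assoc, ← zpow_add₀ h.q_ne_zero,
      Finset.prod_empty, mul_one]
    have e1 : ∀ i : ℕ, (i : ℤ) + -((N : ℤ) + 1) = i - N - 1 := fun i => by ring
    have e2 : ∀ i : ℕ, -((i : ℤ) - N - 1) + -((N : ℤ) + 1) = -i := fun i => by ring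
    simp only [e1, e2]
    ring

theorem boundarySum_reflect {F : Type*} [Field F] {q z : F} (h : IsGenericPair q z)
    {N : ℕ} (hN : Even N) (k l r : ℤ) :
    boundarySum q⁻¹ (q ^ ((N : ℤ) + 1) * z) N k r l = boundarySum q z N k l r := by
  unfold boundarySum
  rw [← Finset.sum_range_reflect]
  refine Finset.sum_congr rfl fun m hm => ?_
  rw [Finset.mem_range] at hm
  rw [show N + 1 - 1 - m = N - m by omega, show N - (N - m) = m by omega,
    vertexTerm_reflect h (by omega)]
  congr 1
  rw [neg_one_pow_eq_pow_mod_two, neg_one_pow_eq_pow_mod_two (n := m)]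
  have := Nat.even_iff.1 hN
  congr 1
  omega

theorem boundarySum_even_compl {F : Type*} [Field F] {q z : F} (h : IsGenericPair q z)
    {N : ℕ} (hN : Even N) (hpos : 0 < N) (k l : ℤ) :
    boundarySum q z N k l (k - l) = 0 := by
  obtain ⟨M, rfl⟩ : ∃ M, N = M + 1 := ⟨N - 1, by omega⟩
  have hM : Odd M := by
    rw [Nat.even_iff] at hN
    rw [Nat.odd_iff]
    omega
  have h1 := boundarySum_sub h M k l (k - l)
  rw [boundarySum_odd_self _ _ hM, mul_zero, neg_zero, sub_eq_zero] at h1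
  have h2 := boundarySum_sub (h.reflect ((M + 1 : ℕ) + 1 : ℤ)) M k (k - (l - 1)) (l - 1)
  rw [sub_sub_cancel, boundarySum_odd_self _ _ hM, mul_zero, neg_zero, sub_eq_zero,
    boundarySum_reflect h hN, boundarySum_reflect h hN,
    show k - (l - 1) - 1 = k - l by ring] at h2
  have hfac : ∀ l' : ℤ, boundarySum q z (M + 1) k l' (k - l') =
      latticeMonomial q z (M + 1) (Mvec (M + 1) k l' (k - l') (M + 1) 0) *
        ∑ m ∈ Finset.range (M + 1 + 1), (-1) ^ m / vertexDenom q z (M + 1) m (M + 1 - m) := by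
    intro l'
    unfold boundarySum
    rw [Finset.mul_sum]
    refine Finset.sum_congr rfl fun m hm => ?_
    rw [Finset.mem_range] at hm
    have hv : Mvec (M + 1) k l' (k - l') m (M + 1 - m) =
        Mvec (M + 1) k l' (k - l') (M + 1) 0 := by
      funext j
      have := j.2
      have := Nat.odd_iff.1 hM
      simp only [Mvec]
      split_ifs <;> omega
    rw [vertexTerm, hv]
    ring
  have hm : latticeMonomial q z (M + 1) (Mvec (M + 1) k (l - 1) (k - (l - 1)) (M + 1) 0) =
      latticeMonomial q z (M + 1) (Mvec (M + 1) k l (k - l) (M + 1) 0) *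
        shiftRatio q z (M + 1) := by
    rw [← latticeMonomial_Mvec_sub_one h k l (k - l) (by omega)]
    congr 1
    funext j
    have := j.2
    simp only [Mvec]
    split_ifs <;> omega
  have h3 := h1.trans h2.symm
  rw [hfac (l - 1), hm, mul_right_comm, ← hfac l] at h3
  have h4 : boundarySum q z (M + 1) k l (k - l) * (1 - shiftRatio q z (M + 1)) = 0 := by
    linear_combination h3
  exact (mul_eq_zero.1 h4).resolve_right (h.one_sub_shiftRatio_ne_zero M)

/-- The lattice-point generating polynomial, with `q` and `z` specialized to a field. -/
def latticeSum {F : Type*} [Field F] (q z : F) (N : ℕ) (k l r : ℤ) : F :=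
  ∑ᶠ a ∈ ASet N k l r, latticeMonomial q z N a

theorem ASet_finite (N : ℕ) (k l r : ℤ) : (ASet N k l r).Finite := by
  refine (Set.finite_Icc (0 : Fin N → ℤ) (fun _ => max l k)).subset ?_
  rintro a ⟨h0, hl, -, hk⟩
  refine ⟨h0, fun j => ?_⟩
  obtain ⟨j, hj⟩ := j
  rcases j with _ | j
  · exact (hl hj).trans (le_max_left _ _)
  · have h1 := hk ⟨j, by omega⟩ hj
    have h2 := h0 ⟨j, by omega⟩
    have h3 : a ⟨j + 1, hj⟩ ≤ k := by
      dsimp only at h1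
      omega
    exact h3.trans (le_max_right l k)

theorem latticeSum_neg_one {F : Type*} [Field F] (q z : F) (N : ℕ) (k r : ℤ) :
    latticeSum q z (N + 1) k (-1) r = 0 := by
  have : ASet (N + 1) k (-1) r = ∅ := by
    refine Set.eq_empty_iff_forall_notMem.2 ?_
    rintro a ⟨h0, hl, -⟩
    have h1 := h0 ⟨0, by omega⟩
    have h2 := hl (by omega)
    omega
  rw [latticeSum, this, finsum_mem_empty]

theorem ASet_succ_zero_of_lt (k : ℤ) {l r : ℤ} (hl : r < l) :
    ASet 1 k l r = ASet 1 k (l - 1) r := by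
  ext a
  simp only [ASet, Set.mem_ofPred_eq]
  refine and_congr_right fun _ => ?_
  constructor
  · rintro ⟨-, h2, h3⟩
    exact ⟨fun h => by have := h2 h; simp only [Nat.sub_self] at this; omega, h2, h3⟩
  · rintro ⟨h1, h2, h3⟩
    exact ⟨fun h => by have := h1 h; omega, h2, h3⟩

theorem ASet_succ {N : ℕ} {k l r : ℤ} (hl : 0 ≤ l) (hN : N = 0 → l ≤ r) :
    ASet (N + 1) k l r = ASet (N + 1) k (l - 1) r ∪ Fin.cons l '' ASet N k (k - l) r := by
  ext a
  constructor
  · rintro ⟨h0, h1, h2, h3⟩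
    by_cases ha : a 0 = l
    · right
      refine ⟨Fin.tail a, ⟨fun i => h0 _, fun h => ?_, fun h => ?_, fun t ht => ?_⟩, ?_⟩
      · have := h3 0 (by simpa using h)
        simp only [Fin.tail]
        have e : (Fin.succ ⟨0, h⟩ : Fin (N + 1)) = ⟨(0 : Fin (N + 1)).1 + 1, by simpa using h⟩ := rfl
        rw [e]
        omega
      · have := h2 (by omega)
        simp only [Fin.tail]
        have e : (Fin.succ ⟨N - 1, Nat.sub_lt h Nat.one_pos⟩ : Fin (N + 1)) =
            ⟨N + 1 - 1, by omega⟩ := by ext; simp; omega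
        rw [e]
        exact this
      · exact h3 t.succ (by simpa using ht)
      · rw [← ha]
        exact Fin.cons_self_tail a
    · left
      refine ⟨h0, fun h => ?_, h2, h3⟩
      have := h1 h
      have e : (⟨0, h⟩ : Fin (N + 1)) = 0 := rfl
      rw [e] at this ⊢
      omega
  · rintro (⟨h0, h1, h2, h3⟩ | ⟨b, ⟨h0, h1, h2, h3⟩, rfl⟩)
    · exact ⟨h0, fun h => by have := h1 h; omega, h2, h3⟩
    · refine ⟨fun i => ?_, fun h => ?_, fun h => ?_, fun t ht => ?_⟩
      · refine Fin.cases ?_ (fun i => ?_) i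
        · simpa using hl
        · simpa using h0 i
      · exact le_of_eq rfl
      · rcases N with _ | N
        · exact hN rfl
        · exact h2 (by omega)
      · obtain ⟨t, htN⟩ := t
        rcases t with _ | t
        · have := h1 (by simpa using ht)
          change l + b ⟨0, _⟩ ≤ k
          omega
        · exact h3 ⟨t, by omega⟩ (by simpa using ht)

theorem latticeSum_succ {F : Type*} [Field F] {q z : F} (h : IsGenericPair q z)
    {N : ℕ} {k l r : ℤ} (hl : 0 ≤ l) (hN : N = 0 → l ≤ r) :
    latticeSum q z (N + 1) k l r =
      latticeSum q z (N + 1) k (l - 1) r + (q * z) ^ l * latticeSum q (q * z) N k (k - l) r := by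
  unfold latticeSum
  rw [ASet_succ hl hN, finsum_mem_union _ (ASet_finite _ _ _ _) ((ASet_finite _ _ _ _).image _),
    finsum_mem_image, mul_finsum_mem]
  · simp only [latticeMonomial_cons h]
  · exact fun a _ b _ hab => (Fin.cons_injective2 hab).2
  · rw [Set.disjoint_left]
    rintro _ ⟨-, h1, -⟩ ⟨b, -, rfl⟩
    have : l ≤ l - 1 := h1 (Nat.succ_pos N)
    omega

/-- The value of `l` at which both boundary sums agree. -/
def boundaryParam (N : ℕ) (k r : ℤ) : ℤ := if N % 2 = 0 then k - r else r

theorem boundaryParam_succ (N : ℕ) (k r : ℤ) :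
    boundaryParam (N + 1) k r = k - boundaryParam N k r := by
  unfold boundaryParam
  split_ifs <;> omega

theorem vertexSum_zero_eq_one {F : Type*} [Field F] {q z : F} (h : IsGenericPair q z)
    (N : ℕ) (k r : ℤ) :
    vertexSum q z (N + 1) 0 k (boundaryParam (N + 1) k r) r =
      vertexSum q z (N + 1) 1 k (boundaryParam (N + 1) k r) r := by
  rw [← sub_eq_zero, vertexSum_zero_sub_one, boundaryParam]
  split_ifs with hp
  · have := boundarySum_even_compl h (Nat.even_iff.2 hp) (by omega) k (k - r)
    rwa [sub_sub_cancel] at this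
  · exact boundarySum_odd_self q z (Nat.odd_iff.2 (by omega)) k r

/-- `latticeSum`, modified for `N = 0` so that the recursion in `l` holds uniformly. -/
def extendedLatticeSum {F : Type*} [Field F] (q z : F) (N : ℕ) (k l r : ℤ) : F :=
  if N = 0 ∧ l < k - r then 0 else latticeSum q z N k l r

theorem extendedLatticeSum_succ {F : Type*} [Field F] {q z : F} (h : IsGenericPair q z)
    {N : ℕ} {k l r : ℤ} (hl : 0 ≤ l) :
    latticeSum q z (N + 1) k l r = latticeSum q z (N + 1) k (l - 1) r +
      (q * z) ^ l * extendedLatticeSum q (q * z) N k (k - l) r := by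
  unfold extendedLatticeSum
  split_ifs with hc
  · obtain ⟨rfl, hlr⟩ := hc
    rw [latticeSum, latticeSum, ASet_succ_zero_of_lt k (show r < l by omega), mul_zero, add_zero]
  · exact latticeSum_succ h hl fun h0 => by
      by_contra hlt
      exact hc ⟨h0, by omega⟩

theorem latticeSum_eq_vertexSum_one {F : Type*} [Field F] {q : F} {N : ℕ} {k r : ℤ}
    (hN : ∀ z : F, IsGenericPair q z → ∀ l : ℤ, 0 ≤ l → l ≤ k → boundaryParam N k r ≤ l →
      extendedLatticeSum q z N k l r = vertexSum q z N 0 k l r)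
    {z : F} (h : IsGenericPair q z) {l : ℤ} (hl : -1 ≤ l) (hlk : l ≤ k)
    (hle : l ≤ boundaryParam (N + 1) k r) :
    latticeSum q z (N + 1) k l r = vertexSum q z (N + 1) 1 k l r := by
  rw [boundaryParam_succ] at hle
  induction l, hl using Int.leInduction with
  | base => rw [latticeSum_neg_one, vertexSum_one_neg_one h]
  | succ l hl ih =>
    have h1 := vertexSum_sub h N le_rfl k (l + 1) r
    rw [add_sub_cancel_right] at h1
    rw [extendedLatticeSum_succ h (by omega), add_sub_cancel_right, ih (by omega) (by omega),
      hN _ h.mul (k - (l + 1)) (by omega) (by omega) (by omega)]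
    linear_combination -h1

theorem extendedLatticeSum_eq_vertexSum {F : Type*} [Field F] {q : F} (N : ℕ) {k r : ℤ}
    (hr0 : 0 ≤ r) (hrk : r ≤ k) (z : F) (h : IsGenericPair q z) (l : ℤ) (hl : 0 ≤ l)
    (hlk : l ≤ k) :
    (l < boundaryParam N k r → extendedLatticeSum q z N k l r = vertexSum q z N 1 k l r) ∧
    (boundaryParam N k r ≤ l → extendedLatticeSum q z N k l r = vertexSum q z N 0 k l r) := by
  induction N generalizing z l with
  | zero =>
    constructor <;> intro hc <;> simp only [boundaryParam, Nat.zero_mod, if_true] at hc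
    · rw [extendedLatticeSum, if_pos ⟨rfl, hc⟩]
      simp [vertexSum]
    · rw [extendedLatticeSum, if_neg (by omega)]
      have : ASet 0 k l r = Set.univ := by
        ext a
        simp [ASet]
      simp [vertexSum, vertexTerm, vertexDenom, latticeSum, this, latticeMonomial, phiQ, phiZ,
        finsum_unique]
  | succ N ih =>
    have hO : ∀ l : ℤ, 0 ≤ l → l ≤ k → l ≤ boundaryParam (N + 1) k r →
        latticeSum q z (N + 1) k l r = vertexSum q z (N + 1) 1 k l r := fun l hl hlk hle =>
      latticeSum_eq_vertexSum_one (fun z hz l hl hlk => (ih z hz l hl hlk).2) h (by omega) hlk hle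
    rw [extendedLatticeSum, if_neg (by omega)]
    refine ⟨fun hlt => hO l hl hlk hlt.le, fun hle => ?_⟩
    have hb : 0 ≤ boundaryParam (N + 1) k r ∧ boundaryParam (N + 1) k r ≤ k := by
      unfold boundaryParam
      split_ifs <;> omega
    clear hl
    induction l, hle using Int.leInduction with
    | base => rw [hO _ hb.1 hb.2 le_rfl, vertexSum_zero_eq_one h]
    | succ l hl ih' =>
      have h1 := vertexSum_sub h N (Nat.zero_le 1) k (l + 1) r
      rw [add_sub_cancel_right] at h1
      have hs := boundaryParam_succ N k r
      rw [extendedLatticeSum_succ h (by omega), add_sub_cancel_right, ih' (by omega),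
        (ih _ h.mul (k - (l + 1)) (by omega) (by omega)).1 (by omega)]
      linear_combination -h1

theorem isGenericPair_qK_zK : IsGenericPair qK zK := by
  have hinj := IsFractionRing.injective (MvPolynomial (Fin 2) ℚ) K
  have hq : qK ≠ 0 := fun h0 => X_ne_zero (R := ℚ) (0 : Fin 2) (hinj (h0.trans (map_zero _).symm))
  have hz : zK ≠ 0 := fun h0 => X_ne_zero (R := ℚ) (1 : Fin 2) (hinj (h0.trans (map_zero _).symm))
  have hpow : ∀ n : ℕ, n ≠ 0 → qK ^ n ≠ 1 := fun n hn h0 => by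
    have h1 : (X 0 : MvPolynomial (Fin 2) ℚ) ^ n = 1 := hinj (by simpa [qK] using h0)
    have h2 := congrArg (eval ![0, 0]) h1
    simp [hn] at h2
  refine ⟨hq, hz, fun i hi => ?_, fun i => ?_⟩
  · rcases Int.natAbs_eq i with h | h <;> rw [h]
    · rw [zpow_natCast]
      exact hpow _ (by omega)
    · rw [zpow_neg, zpow_natCast, Ne, inv_eq_one]
      exact hpow _ (by omega)
  · rcases Int.natAbs_eq i with h | h <;> rw [h] <;> intro h0
    · rw [zpow_natCast] at h0
      have h1 : (X 0 : MvPolynomial (Fin 2) ℚ) ^ i.natAbs * X 1 = 1 :=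
        hinj (by simpa [qK, zK] using h0)
      have h2 := congrArg (eval ![1, 0]) h1
      simp at h2
    · rw [zpow_neg, zpow_natCast, inv_mul_eq_one₀ (pow_ne_zero _ hq)] at h0
      have h1 : (X 0 : MvPolynomial (Fin 2) ℚ) ^ i.natAbs = X 1 :=
        hinj (by simpa [qK, zK] using h0)
      have h2 := congrArg (eval ![1, 0]) h1
      simp at h2

theorem dO_eq_vertexSum (N : ℕ) (k l r : ℤ) : dO N k l r = vertexSum qK zK N 1 k l r := by
  unfold dO vertexSum
  rw [Finset.sum_filter, Finset.sum_product_right]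
  refine Finset.sum_congr rfl fun n _ => Finset.sum_congr rfl fun m _ => ?_
  simp only [Nat.odd_iff]
  rfl

theorem lattice_gen_poly_eq_dO_odd (N : ℕ) (hN : 3 ≤ N) (hNodd : Odd N)
    (k l r : ℤ) (hk : 1 ≤ k) (hl0 : 0 ≤ l) (hlr : l ≤ r) (hrk : r ≤ k) :
    pPoly N k l r = dO N k l r := by
  have hb : boundaryParam N k r = r := if_neg (by have := Nat.odd_iff.1 hNodd; omega)
  obtain ⟨M, rfl⟩ : ∃ M, N = M + 1 := ⟨N - 1, by omega⟩
  rw [dO_eq_vertexSum]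
  exact latticeSum_eq_vertexSum_one
    (fun z hz l hl hlk => (extendedLatticeSum_eq_vertexSum M (hl0.trans hlr) hrk z hz l hl hlk).2)
    isGenericPair_qK_zK (by omega) (hlr.trans hrk) (hlr.trans hb.ge)

end
end
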